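/- For every integer n ≥ 1000, the polynomial R_{n,1}(x) has no factor of degree d in ℤ[x] for any d with 1 ≤ d ≤ 7. -/

import Mathlib

open Polynomial Finset

/-- Probabilists' Hermite polynomials over `ℤ`:
`He 0 = 1`, `He 1 = X`, `He (n+1) = X * He n - n * He (n-1)`. -/
noncomputable def He : ℕ → Polynomial ℤ
  | 0 => 1
  | 1 => Polynomial.X
  | n + 2 => Polynomial.X * He (n + 1) - Polynomial.C ((n : ℤ) + 1) * He n

/-- The Wronskian `Wr[He_{n_1}, …, He_{n_r}]` of the Hermite polynomials indexed by
a degree sequence `ns : Fin r → ℕ`; entry `(i,j)` is the `i`-th derivative of `He (ns j)`. -/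
noncomputable def wronskHe {r : ℕ} (ns : Fin r → ℕ) : Polynomial ℤ :=
  Matrix.det (Matrix.of fun i j : Fin r =>
    (fun q : Polynomial ℤ => Polynomial.derivative q)^[(i : ℕ)] (He (ns j)))

/-- `Δ(n_λ) = ∏_{i<j} (n_j - n_i)`. -/
def vand {r : ℕ} (ns : Fin r → ℕ) : ℤ :=
  ∏ j : Fin r, ∏ i ∈ Finset.Iio j, ((ns j : ℤ) - (ns i : ℤ))

/-- The degree sequence `n_λ` of a partition `λ = (λ_1 ≥ … ≥ λ_r)`,
`n_i = λ_{r+1-i} + (i-1)` (indices shifted to start at `0`). -/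
def degSeq {r : ℕ} (lam : Fin r → ℕ) : Fin r → ℕ :=
  fun i => lam i.rev + (i : ℕ)

/-- `d_λ` = (number of odd entries of the degree sequence) − (number of even entries). -/
def dStat {r : ℕ} (ns : Fin r → ℕ) : ℤ :=
  ((Finset.univ.filter fun i => Odd (ns i)).card : ℤ) -
    ((Finset.univ.filter fun i => Even (ns i)).card : ℤ)

/-- `s_λ = d_λ(d_λ+1)/2`, the size of the 2-core of `λ`. -/
def sStat {r : ℕ} (ns : Fin r → ℕ) : ℕ :=
  (dStat ns * (dStat ns + 1) / 2).toNat

theorem He_add_two (n : ℕ) : He (n + 2) = X * He (n + 1) - C ((n : ℤ) + 1) * He n := rfl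

theorem derivative_He (n : ℕ) : derivative (He (n + 1)) = C ((n : ℤ) + 1) * He n := by
  induction n using Nat.strong_induction_on with
  | _ n ih =>
    match n with
    | 0 => simp [He]
    | 1 => simp [He]; ring
    | k + 2 =>
      rw [He_add_two (k + 1), derivative_sub, derivative_mul, derivative_X, derivative_C_mul,
        ih (k + 1) (by omega), ih k (by omega), He_add_two]
      simp only [map_add, map_natCast, map_one, Nat.cast_add, Nat.cast_one, Nat.cast_ofNat, map_ofNat]
      ring

/-- The recursion of the Hermite coefficients that comes from `He'' = X * He' - N * He`. -/
theorem coeff_He_add_two (N k : ℕ) :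
    ((k : ℤ) + 2) * (k + 1) * (He (N + 2)).coeff (k + 2) =
      -((N : ℤ) + 2 - k) * (He (N + 2)).coeff k := by
  have h : derivative (derivative (He (N + 2))) =
      X * derivative (He (N + 2)) - C ((N : ℤ) + 2) * He (N + 2) := by
    rw [derivative_He (N + 1), derivative_C_mul, derivative_He N, He_add_two]
    simp only [map_add, map_natCast, map_one, Nat.cast_add, Nat.cast_one, map_ofNat]
    ring
  have h2 := congrArg (fun q => coeff q k) h
  rcases k with _ | k
  · simp [coeff_derivative] at h2 ⊢
    linarith
  · simp only [coeff_sub, coeff_C_mul, coeff_X_mul, coeff_derivative] at h2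
    push_cast at h2 ⊢
    linarith

/-- The Wronskian Hermite polynomial of the partition `(k + 1, 1)`. -/
noncomputable def hookHe (k : ℕ) : ℤ[X] := X * He (k + 1) + He k

theorem hookHe_mul (k : ℕ) :
    C ((k : ℤ) + 1) * hookHe k = C ((k : ℤ) + 2) * (X * He (k + 1)) - He (k + 2) := by
  rw [hookHe, He_add_two]
  simp only [map_add, map_natCast, map_one, map_ofNat]
  ring

theorem coeff_hookHe (k i : ℕ) :
    ((k : ℤ) + 1) * (hookHe k).coeff i = ((i : ℤ) - 1) * (He (k + 2)).coeff i := by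
  have h := congrArg (fun q => coeff q i) (hookHe_mul k)
  have h' := congrArg (fun q => coeff q i) (congrArg (fun q => X * q) (derivative_He (k + 1)))
  rcases i with _ | i
  · simp at h ⊢
    linarith
  · simp only [coeff_sub, coeff_C_mul, coeff_X_mul, coeff_derivative] at h h'
    push_cast at h h' ⊢
    linarith

theorem eq_hookHe (k : ℕ) (HeL : ℤ[X])
    (h : C (vand (degSeq ![k + 1, 1])) * HeL = wronskHe (degSeq ![k + 1, 1])) :
    HeL = hookHe k := by
  have h0 : degSeq ![k + 1, 1] 0 = 1 := rfl
  have h1 : degSeq ![k + 1, 1] 1 = k + 2 := rfl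
  have hv : vand (degSeq ![k + 1, 1]) = (k : ℤ) + 1 := by
    have e0 : (Finset.Iio (0 : Fin 2)) = ∅ := rfl
    have e1 : (Finset.Iio (1 : Fin 2)) = {0} := rfl
    simp only [vand, Fin.prod_univ_two, e0, e1, Finset.prod_empty, Finset.prod_singleton, h0, h1]
    push_cast
    ring
  have hw : wronskHe (degSeq ![k + 1, 1]) = C ((k : ℤ) + 1) * hookHe k := by
    rw [hookHe_mul, wronskHe, Matrix.det_fin_two]
    simp only [Matrix.of_apply, h0, h1, Fin.val_zero, Fin.val_one, Function.iterate_zero,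
      Function.iterate_one, id, derivative_He (k + 1)]
    simp [He]
    ring
  rw [hv, hw] at h
  exact mul_left_cancel₀ (C_ne_zero.2 (by positivity)) h

theorem sStat_of_odd (m : ℕ) : sStat (degSeq ![2 * m + 1, 1]) = 0 := by
  have h0 : degSeq ![2 * m + 1, 1] 0 = 1 := rfl
  have h1 : degSeq ![2 * m + 1, 1] 1 = 2 * m + 2 := rfl
  have e : dStat (degSeq ![2 * m + 1, 1]) = 0 := by
    have o : ¬ Odd (2 * m + 2) := by rw [Nat.not_odd_iff_even]; exact ⟨m + 1, by ring⟩
    have o' : Even (2 * m + 2) := ⟨m + 1, by ring⟩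
    simp only [dStat, Finset.card_filter, Fin.sum_univ_two, h0, h1]
    simp [o, o']
  simp [sStat, e]

theorem sStat_of_even (m : ℕ) : sStat (degSeq ![2 * m + 2, 1]) = 3 := by
  have h0 : degSeq ![2 * m + 2, 1] 0 = 1 := rfl
  have h1 : degSeq ![2 * m + 2, 1] 1 = 2 * m + 3 := rfl
  have e : dStat (degSeq ![2 * m + 2, 1]) = 2 := by
    have o : ¬ Even (2 * m + 3) := by rw [Nat.not_even_iff_odd]; exact ⟨m + 1, by ring⟩
    have o' : Odd (2 * m + 3) := ⟨m + 1, by ring⟩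
    simp only [dStat, Finset.card_filter, Fin.sum_univ_two, h0, h1]
    simp [o, o']
  simp [sStat, e]

theorem He_monic_natDegree (n : ℕ) : (He n).Monic ∧ (He n).natDegree = n := by
  induction n using Nat.strong_induction_on with
  | _ n ih =>
    match n with
    | 0 => simp [He]
    | 1 => simp [He]
    | k + 2 =>
      obtain ⟨m1, d1⟩ := ih (k + 1) (by omega)
      obtain ⟨m0, d0⟩ := ih k (by omega)
      have hm : (X * He (k + 1)).Monic := monic_X.mul m1
      have hd : (X * He (k + 1)).natDegree = k + 2 := by
        rw [monic_X.natDegree_mul m1, d1, natDegree_X]; ring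
      have hlt : (C ((k : ℤ) + 1) * He k).degree < (X * He (k + 1)).degree := by
        refine degree_lt_degree ?_
        rw [hd]
        exact (natDegree_C_mul_le _ _).trans_lt (by omega)
      exact ⟨hm.sub_of_left hlt, by
        rw [He_add_two, natDegree_sub_eq_left_of_natDegree_lt
          (natDegree_lt_natDegree_iff ((mul_ne_zero_iff.2 ⟨C_ne_zero.2 (by positivity), m0.ne_zero⟩)) |>.2 hlt), hd]⟩

theorem hookHe_monic (k : ℕ) : (hookHe k).Monic := by
  obtain ⟨m1, d1⟩ := He_monic_natDegree (k + 1)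
  obtain ⟨m0, d0⟩ := He_monic_natDegree k
  refine (monic_X.mul m1).add_of_left (degree_lt_degree ?_)
  rw [monic_X.natDegree_mul m1, d1, natDegree_X, d0]
  omega

/-- Dumas-type criterion: if every coefficient `c i`, `i ≥ 1`, of `g * h` lies strictly above the
line of slope `-1 / d` through the constant coefficient, and `g` has degree `d` and leading
coefficient prime to `p`, then `p` does not divide the constant coefficient of `g`. -/
theorem not_dvd_coeff_zero_of_newton {p : ℕ} [hp : Fact p.Prime] {g h : ℤ[X]} {d : ℕ}
    (hd : 1 ≤ d) (hg : g.natDegree = d) (hlc : ¬ (p : ℤ) ∣ g.leadingCoeff)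
    (h0 : (g * h).coeff 0 ≠ 0)
    (H : ∀ i, 1 ≤ i → (g * h).coeff i ≠ 0 →
      d * padicValInt p ((g * h).coeff 0) < i + d * padicValInt p ((g * h).coeff i)) :
    ¬ (p : ℤ) ∣ g.coeff 0 := by
  intro hdvd
  -- the last index at which the minimal height is attained
  have key : ∀ f : ℤ[X], f ≠ 0 → ∃ A, f.coeff A ≠ 0 ∧
      (∀ i, f.coeff i ≠ 0 → d * padicValInt p (f.coeff A) + A ≤ d * padicValInt p (f.coeff i) + i) ∧
      (∀ i, A < i → f.coeff i ≠ 0 →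
        d * padicValInt p (f.coeff A) + A < d * padicValInt p (f.coeff i) + i) := by
    intro f hf
    obtain ⟨B, hB, hBmin⟩ := f.support.exists_min_image
      (fun i => d * padicValInt p (f.coeff i) + i) (nonempty_support_iff.2 hf)
    let S := f.support.filter fun i =>
      d * padicValInt p (f.coeff i) + i = d * padicValInt p (f.coeff B) + B
    have hS : S.Nonempty := ⟨B, by simp [S]; simpa using hB⟩
    obtain ⟨A, hm, hmax⟩ : ∃ A ∈ S, ∀ i ∈ S, i ≤ A := ⟨_, S.max'_mem hS, fun i hi => S.le_max' i hi⟩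
    simp only [S, Finset.mem_filter, mem_support_iff] at hm hmax hBmin
    refine ⟨A, hm.1, fun i hi => hm.2.trans_le (hBmin i hi), fun i hAi hi => ?_⟩
    refine lt_of_le_of_ne (hm.2.trans_le (hBmin i hi)) fun he => ?_
    have := hmax i ⟨hi, he.symm.trans hm.2⟩
    omega
  rw [mul_coeff_zero] at h0
  have hg0 : g.coeff 0 ≠ 0 := left_ne_zero_of_mul h0
  have hh0 : h.coeff 0 ≠ 0 := right_ne_zero_of_mul h0
  obtain ⟨A, hA0, hA1, hA2⟩ := key g fun e => hg0 (by simp [e])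
  obtain ⟨B, hB0, hB1, hB2⟩ := key h fun e => hh0 (by simp [e])
  have hApos : 1 ≤ A := by
    by_contra hA
    obtain rfl : A = 0 := by omega
    have h1 := hA2 d (by omega) (by
      rw [← hg]; exact fun e => hlc (by rw [leadingCoeff, e]; exact dvd_zero _))
    have h2 : padicValInt p (g.coeff d) = 0 := by
      rw [← hg]; exact padicValInt.eq_zero_of_not_dvd hlc
    have h3 : 1 ≤ padicValInt p (g.coeff 0) := by
      have := (padicValInt_dvd_iff 1 (g.coeff 0)).1 (by simpa using hdvd)
      tauto
    have := Nat.mul_le_mul_left d h3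
    rw [h2] at h1
    omega
  set v := padicValInt p (g.coeff A) + padicValInt p (h.coeff B) with hv
  have hAB : ¬ (p : ℤ) ^ (v + 1) ∣ (g * h).coeff (A + B) := by
    rw [coeff_mul, ← Finset.add_sum_erase _ _ (show (A, B) ∈ Finset.HasAntidiagonal.antidiagonal (A + B) by simp)]
    have hrest : (p : ℤ) ^ (v + 1) ∣
        ∑ x ∈ (Finset.HasAntidiagonal.antidiagonal (A + B)).erase (A, B), g.coeff x.1 * h.coeff x.2 := by
      refine Finset.dvd_sum fun x hx => ?_
      obtain ⟨hne, hx⟩ := Finset.mem_erase.1 hx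
      rw [Finset.HasAntidiagonal.mem_antidiagonal] at hx
      by_cases hi : g.coeff x.1 = 0
      · simp [hi]
      by_cases hj : h.coeff x.2 = 0
      · simp [hj]
      refine (padicValInt_dvd_iff _ _).2 (Or.inr ?_)
      rw [padicValInt.mul hi hj]
      have a1 := hA1 _ hi
      have b1 := hB1 _ hj
      have : d * v < d * (padicValInt p (g.coeff x.1) + padicValInt p (h.coeff x.2)) := by
        rw [hv, mul_add, mul_add]
        rcases lt_trichotomy A x.1 with hlt | heq | hgt
        · have := hA2 _ hlt hi
          omega
        · exact absurd (Prod.ext heq.symm (by omega)) hne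
        · have := hB2 x.2 (by omega) hj
          omega
      exact Nat.lt_of_mul_lt_mul_left this
    rw [dvd_add_left hrest, padicValInt_dvd_iff, padicValInt.mul hA0 hB0]
    simp [hA0, hB0, hv]
  have hne : (g * h).coeff (A + B) ≠ 0 := fun e => hAB (by rw [e]; exact dvd_zero _)
  have hle : padicValInt p ((g * h).coeff (A + B)) ≤ v := by
    by_contra hlt
    exact hAB ((padicValInt_dvd_iff _ _).2 (Or.inr (by omega)))
  have h1 := H (A + B) (by omega) hne
  rw [mul_coeff_zero, padicValInt.mul hg0 hh0] at h1
  have a1 := hA1 0 hg0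
  have b1 := hB1 0 hh0
  have := Nat.mul_le_mul_left d hle
  rw [hv, mul_add] at this
  rw [mul_add] at h1
  omega

/-- Reduction of `He n` modulo `p`. -/
noncomputable def HeMod (p n : ℕ) : (ZMod p)[X] := (He n).map (Int.castRingHom (ZMod p))

theorem HeMod_add_two (p n : ℕ) :
    HeMod p (n + 2) = X * HeMod p (n + 1) - C ((n : ZMod p) + 1) * HeMod p n := by
  simp [HeMod, He_add_two]

theorem coeff_He_eq_zero (N : ℕ) : ∀ i, Odd (N + i) → (He N).coeff i = 0 := by
  induction N using Nat.strong_induction_on with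
  | _ N ih =>
    match N with
    | 0 =>
      intro i hi
      rw [He, coeff_one, if_neg (by rintro rfl; simp at hi)]
    | 1 =>
      intro i hi
      rw [He, coeff_X, if_neg (by rintro rfl; exact absurd hi (by decide))]
    | k + 2 =>
      intro i hi
      have h0 : (He k).coeff i = 0 := ih k (by omega) i (by rw [Nat.odd_iff] at hi ⊢; omega)
      rw [He_add_two, coeff_sub, coeff_C_mul, h0]
      rcases i with _ | i
      · simp
      · rw [coeff_X_mul, ih (k + 1) (by omega) i (by rw [Nat.odd_iff] at hi ⊢; omega)]
        simp

theorem HeMod_prime {p : ℕ} [hp : Fact p.Prime] (h2 : p ≠ 2) : HeMod p p = X ^ p := by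
  obtain ⟨m, hm⟩ := hp.out.odd_of_ne_two h2
  obtain ⟨hmon, hdeg⟩ := He_monic_natDegree p
  have hder : ∀ k : ℕ, ((He p).coeff (k + 1) : ZMod p) * (k + 1) = 0 := by
    intro k
    have h := derivative_He (2 * m)
    rw [← hm] at h
    have h' := congrArg (fun q => ((coeff q k : ℤ) : ZMod p)) h
    simp only [coeff_derivative, coeff_C_mul] at h'
    have e : (((2 * m : ℕ) : ZMod p) + 1) = 0 := by
      have : ((2 * m + 1 : ℕ) : ZMod p) = 0 := (congrArg Nat.cast hm).symm.trans (ZMod.natCast_self p)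
      exact_mod_cast this
    push_cast at h' e ⊢
    rw [h', e, zero_mul]
  ext i
  rw [HeMod, coeff_map, coeff_X_pow]
  rcases lt_trichotomy i p with hlt | rfl | hgt
  · rw [if_neg hlt.ne]
    rcases i with _ | i
    · rw [coeff_He_eq_zero p 0 (by rw [hm, Nat.odd_iff]; omega)]; simp
    · rcases mul_eq_zero.1 (hder i) with h | h
      · simpa using h
      · have : ((i + 1 : ℕ) : ZMod p) = 0 := by exact_mod_cast h
        rw [ZMod.natCast_eq_zero_iff] at this
        exact absurd (Nat.le_of_dvd (by omega) this) (by omega)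
  · have : (He i).coeff i = 1 := by simpa [Monic, leadingCoeff, hdeg] using hmon
    simp [this]
  · rw [if_neg hgt.ne', coeff_eq_zero_of_natDegree_lt (by omega)]
    simp

theorem HeMod_add_prime {p : ℕ} [hp : Fact p.Prime] (h2 : p ≠ 2) (n : ℕ) :
    HeMod p (p + n) = X ^ p * HeMod p n := by
  induction n using Nat.strong_induction_on with
  | _ n ih =>
    match n with
    | 0 => simp [HeMod_prime h2, show HeMod p 0 = 1 by simp [HeMod, He]]
    | 1 =>
      obtain ⟨q, hq⟩ : ∃ q, p = q + 1 := ⟨p - 1, by have := hp.out.pos; omega⟩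
      have e : ((q : ZMod p) + 1) = 0 := by
        have : ((q + 1 : ℕ) : ZMod p) = 0 :=
          (congrArg Nat.cast hq).symm.trans (ZMod.natCast_self p)
        exact_mod_cast this
      have h := HeMod_add_two p q
      rw [e, C_0, zero_mul, sub_zero, ← hq, HeMod_prime h2, show q + 2 = p + 1 by omega] at h
      rw [h, show HeMod p 1 = X by simp [HeMod, He], mul_comm]
    | k + 2 =>
      rw [← add_assoc, HeMod_add_two, HeMod_add_two, add_assoc, ih (k + 1) (by omega),
        ih k (by omega)]
      simp only [Nat.cast_add, CharP.cast_eq_zero, zero_add]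
      ring

theorem HeMod_mul_prime_add {p : ℕ} [hp : Fact p.Prime] (h2 : p ≠ 2) (q n : ℕ) :
    HeMod p (p * q + n) = X ^ (p * q) * HeMod p n := by
  induction q with
  | zero => simp
  | succ q ih =>
    rw [show p * (q + 1) + n = p + (p * q + n) by ring, HeMod_add_prime h2, ih]
    ring

theorem hookHe_map (p k : ℕ) :
    (hookHe k).map (Int.castRingHom (ZMod p)) = X * HeMod p (k + 1) + HeMod p k := by
  simp [hookHe, HeMod]

theorem hookHe_map_of_dvd_add_two {p : ℕ} [hp : Fact p.Prime] (h2 : p ≠ 2) {k : ℕ}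
    (h : p ∣ k + 2) : (hookHe k).map (Int.castRingHom (ZMod p)) = X ^ (k + 2) := by
  obtain ⟨q, hq⟩ := h
  have e : (k : ZMod p) + 2 = 0 := by
    have : ((k + 2 : ℕ) : ZMod p) = 0 := by rw [hq]; simp
    exact_mod_cast this
  have h1 := HeMod_mul_prime_add (p := p) h2 q 0
  rw [← hq, show HeMod p 0 = 1 by simp [HeMod, He], mul_one, HeMod_add_two] at h1
  rw [hookHe_map, ← h1, show (k : ZMod p) + 1 = -1 by linear_combination e]
  simp

theorem hookHe_map_of_dvd_sub_one {p : ℕ} [hp : Fact p.Prime] (h2 : p ≠ 2) {k : ℕ}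
    (h : p ∣ k) : (hookHe (k + 1)).map (Int.castRingHom (ZMod p)) = X ^ (k + 3) := by
  obtain ⟨q, rfl⟩ := h
  rw [hookHe_map, HeMod_mul_prime_add h2, add_assoc, HeMod_mul_prime_add h2]
  have e2 : HeMod p 2 = X ^ 2 - 1 := by simp [HeMod, He]; ring
  have e1 : HeMod p 1 = X := by simp [HeMod, He]
  norm_num [e2, e1]
  ring

theorem hookHe_map_of_dvd_sub_three {p : ℕ} [hp : Fact p.Prime] (h2 : p ≠ 2) {k : ℕ}
    (h : p ∣ k) : (hookHe (k + 3)).map (Int.castRingHom (ZMod p)) =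
      X ^ (k + 3) * (X ^ 2 - C 5) := by
  obtain ⟨q, rfl⟩ := h
  rw [hookHe_map, HeMod_mul_prime_add h2, add_assoc, HeMod_mul_prime_add h2]
  have e3 : HeMod p 3 = X ^ 3 - 3 * X := by simp [HeMod, He]; ring
  have e4 : HeMod p 4 = X ^ 4 - 6 * X ^ 2 + 3 := by simp [HeMod, He]; ring
  norm_num [e3, e4, map_ofNat C 5]
  ring

/-- If `g ∣ R` with `R` monic, `X ^ s * R ≡ X ^ N * q` modulo `p`, and `deg q < deg g`, then `p`
divides the constant coefficient of `g`. -/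
theorem dvd_coeff_zero_of_map_eq {p : ℕ} [hp : Fact p.Prime] {g R : ℤ[X]} {s N : ℕ}
    {q : (ZMod p)[X]} (hq : q ≠ 0) (hqd : q.natDegree < g.natDegree)
    (hlc : ¬ (p : ℤ) ∣ g.leadingCoeff) (hgR : g ∣ R)
    (h : (X ^ s * R).map (Int.castRingHom (ZMod p)) = X ^ N * q) : (p : ℤ) ∣ g.coeff 0 := by
  by_contra h0
  have hlc' : Int.castRingHom (ZMod p) g.leadingCoeff ≠ 0 := by
    simpa [ZMod.intCast_zmod_eq_zero_iff_dvd] using hlc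
  have hX : ¬ X ∣ g.map (Int.castRingHom (ZMod p)) := by
    rw [X_dvd_iff, coeff_map]
    simpa [ZMod.intCast_zmod_eq_zero_iff_dvd] using h0
  have hdvd : g.map (Int.castRingHom (ZMod p)) ∣ X ^ N * q := by
    rw [← h, Polynomial.map_mul]
    exact Dvd.dvd.mul_left (Polynomial.map_dvd _ hgR) _
  have hco : IsCoprime (g.map (Int.castRingHom (ZMod p))) (X ^ N) :=
    ((irreducible_X.coprime_iff_not_dvd.2 hX).symm).pow_right
  have := natDegree_le_of_dvd (hco.dvd_of_dvd_mul_left hdvd) hq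
  rw [natDegree_map_of_leadingCoeff_ne_zero _ hlc'] at this
  omega

/-- The product of the first `j` odd numbers. -/
def oddProd (j : ℕ) : ℕ := ∏ i ∈ Finset.range j, (2 * i + 1)

theorem oddProd_succ (j : ℕ) : oddProd (j + 1) = oddProd j * (2 * j + 1) :=
  Finset.prod_range_succ _ _

theorem oddProd_ne_zero (j : ℕ) : oddProd j ≠ 0 :=
  Finset.prod_ne_zero_iff.2 fun _ _ => by omega

theorem factorial_two_mul (j : ℕ) : (2 * j).factorial = oddProd j * (2 ^ j * j.factorial) := by
  induction j with
  | zero => simp [oddProd]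
  | succ j ih =>
    rw [show 2 * (j + 1) = 2 * j + 1 + 1 by ring, Nat.factorial_succ, Nat.factorial_succ, ih,
      oddProd_succ, Nat.factorial_succ]
    ring

section valuation

variable {p : ℕ} [hp : Fact p.Prime]

theorem padicValNat_factorial_two_mul (h2 : p ≠ 2) (j : ℕ) :
    padicValNat p (2 * j).factorial = padicValNat p (oddProd j) + padicValNat p j.factorial := by
  have hp2 : padicValNat p 2 = 0 := padicValNat_primes h2
  rw [factorial_two_mul, padicValNat.mul (oddProd_ne_zero j) (by positivity),
    padicValNat.mul (by positivity) (by positivity), padicValNat.pow, hp2]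
  simp

theorem padicValNat_factorial_eq_div (n : ℕ) :
    padicValNat p n.factorial = n / p + padicValNat p (n / p).factorial := by
  rw [← padicValNat_mul_div_factorial, padicValNat_factorial_mul, add_comm]

/-- Splitting off the odd multiples of `p`. -/
theorem exists_padicValNat_oddProd (h2 : p ≠ 2) (j : ℕ) :
    ∃ t, padicValNat p (oddProd j) = t + padicValNat p (oddProd t) ∧ 2 * (p * t) ≤ 2 * j + p := by
  have hp0 := hp.out.pos
  have h1 := padicValNat_factorial_two_mul h2 j
  rw [padicValNat_factorial_eq_div (2 * j), padicValNat_factorial_eq_div j] at h1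
  have hj := Nat.div_add_mod j p
  have hr := Nat.mod_lt j hp0
  set u := j / p
  set r := j % p
  by_cases hc : 2 * r < p
  · have e : 2 * j / p = 2 * u := by
      rw [← hj, show 2 * (p * u + r) = 2 * r + p * (2 * u) by ring, Nat.add_mul_div_left _ _ hp0,
        Nat.div_eq_of_lt hc, zero_add]
    rw [e, padicValNat_factorial_two_mul h2 u] at h1
    exact ⟨u, by omega, by omega⟩
  · have e : 2 * j / p = 2 * u + 1 := by
      rw [← hj, show 2 * (p * u + r) = 2 * r + p * (2 * u) by ring, Nat.add_mul_div_left _ _ hp0,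
        Nat.div_eq_of_lt_le (k := 1) (by omega) (by omega)]
      ring
    rw [e, Nat.factorial_succ, padicValNat.mul (by omega) (by positivity),
      padicValNat_factorial_two_mul h2 u] at h1
    refine ⟨u + 1, ?_, by rw [mul_add]; omega⟩
    rw [oddProd_succ, padicValNat.mul (oddProd_ne_zero u) (by omega)]
    omega

theorem padicValNat_oddProd_of_le_three (h7 : 7 ≤ p) {j : ℕ} (hj : j ≤ 3) :
    padicValNat p (oddProd j) = 0 := by
  refine padicValNat.eq_zero_of_not_dvd fun h => ?_
  have hp' := hp.out
  have h15 : p ∣ 15 := by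
    refine h.trans ?_
    interval_cases j <;> decide
  have : p ≤ 15 := Nat.le_of_dvd (by norm_num) h15
  interval_cases p <;> revert h15 hp' <;> decide

theorem padicValNat_oddProd_le (h7 : 7 ≤ p) (j : ℕ) : 7 * padicValNat p (oddProd j) ≤ 2 * j + 1 := by
  induction j using Nat.strong_induction_on with
  | _ j ih =>
    obtain ⟨t, ht, hle⟩ := exists_padicValNat_oddProd (p := p) (by omega) j
    rcases Nat.eq_zero_or_pos t with rfl | ht0
    · have := padicValNat_oddProd_of_le_three h7 (j := 0) (by norm_num)
      omega
    have hpt : 7 * (2 * t - 1) ≤ p * (2 * t - 1) := Nat.mul_le_mul_right _ h7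
    have e : p * (2 * t - 1) + p = 2 * (p * t) := by
      obtain ⟨s, rfl⟩ : ∃ s, t = s + 1 := ⟨t - 1, by omega⟩
      rw [show 2 * (s + 1) - 1 = 2 * s + 1 by omega]
      ring
    rcases Nat.lt_or_ge 1 t with h1 | h1
    · have := ih t (by omega)
      omega
    · have := padicValNat_oddProd_of_le_three h7 (j := t) (by omega)
      omega

theorem padicValNat_oddProd_add_le (h7 : 7 ≤ p) {j : ℕ} (hj : 6 ≤ j) :
    7 * padicValNat p (oddProd j) + 5 ≤ 2 * j := by
  obtain ⟨t, ht, hle⟩ := exists_padicValNat_oddProd (p := p) (by omega) j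
  rcases Nat.eq_zero_or_pos t with rfl | ht0
  · have := padicValNat_oddProd_of_le_three h7 (j := 0) (by norm_num)
    omega
  have hpt : 7 * (2 * t - 1) ≤ p * (2 * t - 1) := Nat.mul_le_mul_right _ h7
  have e : p * (2 * t - 1) + p = 2 * (p * t) := by
    obtain ⟨s, rfl⟩ : ∃ s, t = s + 1 := ⟨t - 1, by omega⟩
    rw [show 2 * (s + 1) - 1 = 2 * s + 1 by omega]
    ring
  rcases Nat.lt_or_ge 3 t with h1 | h1
  · have := padicValNat_oddProd_le h7 t
    omega
  · have := padicValNat_oddProd_of_le_three h7 h1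
    omega

end valuation

theorem cast_choose_succ_mul (m j : ℕ) :
    ((m.choose (j + 1) : ℕ) : ℤ) * (j + 1) = m.choose j * ((m : ℤ) - j) := by
  rcases le_or_gt j m with h | h
  · have := Nat.choose_succ_right_eq m j
    zify [h] at this
    exact this
  · simp [Nat.choose_eq_zero_of_lt h, Nat.choose_eq_zero_of_lt (h.trans (Nat.lt_succ_self j))]

theorem coeff_He_even (m j : ℕ) : (He (2 * m + 2)).coeff (2 * j) * oddProd j =
    (-1) ^ j * (m + 1).choose j * (He (2 * m + 2)).coeff 0 := by
  induction j with
  | zero => simp [oddProd]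
  | succ j ih =>
    have h := coeff_He_add_two (2 * m) (2 * j)
    have hc := cast_choose_succ_mul (m + 1) j
    rw [oddProd_succ, show 2 * (j + 1) = 2 * j + 2 by ring]
    refine mul_left_cancel₀ (show 2 * ((j : ℤ) + 1) ≠ 0 by positivity) ?_
    push_cast at h hc ⊢
    linear_combination (oddProd j : ℤ) * h - 2 * ((m : ℤ) + 1 - j) * ih
      - 2 * (-1) ^ (j + 1) * (He (2 * m + 2)).coeff 0 * hc

theorem coeff_He_odd (m i : ℕ) :
    ((i : ℤ) + 1) * (He (2 * m + 3)).coeff (2 * i + 3) * oddProd (i + 2) =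
    (-1) ^ i * m.choose i * 3 * (He (2 * m + 3)).coeff 3 := by
  induction i with
  | zero => simp [oddProd, Finset.prod_range_succ]; ring
  | succ i ih =>
    have h := coeff_He_add_two (2 * m + 1) (2 * i + 3)
    rw [show 2 * m + 1 + 2 = 2 * m + 3 from rfl] at h
    have hc := cast_choose_succ_mul m i
    rw [oddProd_succ, show 2 * (i + 1) + 3 = 2 * i + 3 + 2 by ring]
    refine mul_left_cancel₀ (show 2 * ((i : ℤ) + 1) ≠ 0 by positivity) ?_
    push_cast at h hc ⊢
    linear_combination ((i : ℤ) + 1) * (oddProd (i + 2) : ℤ) * h - 2 * ((m : ℤ) - i) * ih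
      - 2 * (-1) ^ (i + 1) * 3 * (He (2 * m + 3)).coeff 3 * hc

/-- All prime factors of `N` are at most `5`. -/
def Smooth5 (N : ℕ) : Prop := N ≠ 0 ∧ ∀ p : ℕ, p.Prime → p ∣ N → p < 7

theorem Smooth5.of_dvd {M N : ℕ} (hN : Smooth5 N) (h : M ∣ N) : Smooth5 M :=
  ⟨ne_zero_of_dvd_ne_zero hN.1 h, fun p hp hM => hN.2 p hp (hM.trans h)⟩

theorem Smooth5.exists_eq {N : ℕ} (hN : Smooth5 N) : ∃ a b c, N = 2 ^ a * 3 ^ b * 5 ^ c := by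
  induction N using Nat.strong_induction_on with
  | _ N ih =>
    rcases eq_or_ne N 1 with rfl | h1
    · exact ⟨0, 0, 0, rfl⟩
    have hp := Nat.minFac_prime h1
    obtain ⟨M, hM⟩ := Nat.minFac_dvd N
    have h7 := hN.2 _ hp (Nat.minFac_dvd N)
    generalize N.minFac = q at *
    have hM0 : M ≠ 0 := by rintro rfl; exact hN.1 (by simpa using hM)
    obtain ⟨a, b, c, e⟩ := ih M (by
      rw [hM]; exact lt_mul_of_one_lt_left (Nat.pos_of_ne_zero hM0) hp.one_lt)
      (hN.of_dvd ⟨q, by rw [hM, mul_comm]⟩)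
    have h2 := hp.two_le
    interval_cases q
    · exact ⟨a + 1, b, c, by rw [hM, e]; ring⟩
    · exact ⟨a, b + 1, c, by rw [hM, e]; ring⟩
    · exact absurd hp (by norm_num)
    · exact ⟨a, b, c + 1, by rw [hM, e]; ring⟩
    · exact absurd hp (by norm_num)

theorem pow_modEq_pow_mod {x k M : ℕ} (h : x ^ k % M = 1 % M) (a : ℕ) :
    x ^ a ≡ x ^ (a % k) [MOD M] := by
  conv_lhs => rw [← Nat.div_add_mod a k, pow_add, pow_mul]
  simpa using ((show x ^ k ≡ 1 [MOD M] from h).pow (a / k)).mul_right (x ^ (a % k))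

/-- If `x ^ a + s ≡ 0` modulo `P` forces `x ^ a + s ≡ 0` modulo `q`, as checked on one period,
and `x ^ a + s` is congruent to a smooth number `N` modulo `P * q`, then `P ∤ N`. -/
theorem Smooth5.not_dvd {x k P q s a N : ℕ} (hx : x ^ k % (P * q) = 1 % (P * q)) (hk : 0 < k)
    (hdec : ∀ r < k, P ∣ x ^ r + s → q ∣ x ^ r + s) (hq : q.Prime) (h7 : 7 ≤ q)
    (hN : Smooth5 N) (ha : N ≡ x ^ a + s [MOD P * q]) : ¬ P ∣ N := by
  intro hP
  have h : N ≡ x ^ (a % k) + s [MOD P * q] := ha.trans ((pow_modEq_pow_mod hx a).add_right s)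
  have h1 := ((h.of_mul_right q).dvd_iff dvd_rfl).1 hP
  have h2 := ((h.of_mul_left P).dvd_iff dvd_rfl).2 (hdec _ (Nat.mod_lt _ hk) h1)
  exact absurd (hN.2 q hq h2) (by omega)

theorem lt_of_not_pow_dvd {p k b M N : ℕ} (h : ¬ p ^ k ∣ N) (hN : p ^ b * M = N) : b < k := by
  by_contra hb
  exact h (hN ▸ (pow_dvd_pow p (by omega)).mul_right M)

theorem exponent_eq_zero_or {p a b M N u t : ℕ} (hM : u = p ^ a * M) (hN : u + t = p ^ b * N)
    (hp : ¬ p ∣ t) : a = 0 ∨ b = 0 := by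
  by_contra! h
  refine hp ((Nat.dvd_add_right (b := u) ?_).1 ?_)
  · rw [hM]; exact (dvd_pow_self p h.1).mul_right M
  · rw [hN]; exact (dvd_pow_self p h.2).mul_right N

/-- Størmer's theorem for the primes `2, 3, 5`. -/
theorem le_eighty_of_smooth5 {u : ℕ} (hu : Smooth5 u) (hu' : Smooth5 (u + 1)) : u ≤ 80 := by
  obtain ⟨a, b, c, e⟩ := hu.exists_eq
  obtain ⟨a', b', c', e'⟩ := hu'.exists_eq
  have h2 : a = 0 ∨ a' = 0 := exponent_eq_zero_or (u := u) (p := 2) (t := 1)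
    (M := 3 ^ b * 5 ^ c) (N := 3 ^ b' * 5 ^ c') (by rw [e]; ring) (by rw [e']; ring) (by norm_num)
  have h3 : b = 0 ∨ b' = 0 := exponent_eq_zero_or (u := u) (p := 3) (t := 1)
    (M := 2 ^ a * 5 ^ c) (N := 2 ^ a' * 5 ^ c') (by rw [e]; ring) (by rw [e']; ring) (by norm_num)
  have h5 : c = 0 ∨ c' = 0 := exponent_eq_zero_or (u := u) (p := 5) (t := 1)
    (M := 2 ^ a * 3 ^ b) (N := 2 ^ a' * 3 ^ b') (by rw [e]; ring) (by rw [e']; ring) (by norm_num)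
  have add : ∀ {x i : ℕ} (k P q : ℕ), u = x ^ i → x ^ k % (P * q) = 1 % (P * q) → 0 < k →
      (∀ r < k, P ∣ x ^ r + 1 → q ∣ x ^ r + 1) → q.Prime → 7 ≤ q → ¬ P ∣ u + 1 :=
    fun k P q hi hx hk hdec hq h7 => Smooth5.not_dvd hx hk hdec hq h7 hu' (by rw [hi])
  have sub : ∀ {x i : ℕ} (k P q : ℕ), u + 1 = x ^ i → x ^ k % (P * q) = 1 % (P * q) → 0 < k →
      (∀ r < k, P ∣ x ^ r + (P * q - 1) → q ∣ x ^ r + (P * q - 1)) → q.Prime → 7 ≤ q → 0 < P →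
      ¬ P ∣ u := by
    intro x i k P q hi hx hk hdec hq h7 hP
    refine Smooth5.not_dvd (a := i) hx hk hdec hq h7 hu ?_
    have : 0 < P * q := Nat.mul_pos hP (by omega)
    rw [← hi, show u + 1 + (P * q - 1) = u + P * q by omega]
    simp [Nat.ModEq]
  rcases h2 with rfl | rfl <;> rcases h3 with rfl | rfl <;> rcases h5 with rfl | rfl <;>
    simp only [pow_zero, one_mul, mul_one] at e e'
  · omega
  · have k1 := add 6 (2 ^ 2) 7 e (by norm_num) (by norm_num)
      (by decide +kernel) (by norm_num) (by norm_num)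
    have k2 := add 6 (3 ^ 2) 7 e (by norm_num) (by norm_num)
      (by decide +kernel) (by norm_num) (by norm_num)
    have l1 := lt_of_not_pow_dvd k1 e'.symm
    have l2 := lt_of_not_pow_dvd k2 ((mul_comm _ _).trans e'.symm)
    interval_cases a' <;> interval_cases b' <;> omega
  · have k1 := add 6 (2 ^ 3) 7 e (by norm_num) (by norm_num)
      (by decide +kernel) (by norm_num) (by norm_num)
    have k2 := add 20 (5 ^ 2) 1181 e (by norm_num) (by norm_num)
      (by decide +kernel) (by norm_num) (by norm_num)
    have l1 := lt_of_not_pow_dvd k1 e'.symm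
    have l2 := lt_of_not_pow_dvd k2 ((mul_comm _ _).trans e'.symm)
    interval_cases a' <;> interval_cases c' <;> omega
  · have k1 := sub 6 (3 ^ 2) 7 e' (by norm_num) (by norm_num)
      (by decide +kernel) (by norm_num) (by norm_num) (by norm_num)
    have k2 := sub 20 (5 ^ 2) 11 e' (by norm_num) (by norm_num)
      (by decide +kernel) (by norm_num) (by norm_num) (by norm_num)
    have l1 := lt_of_not_pow_dvd k1 e.symm
    have l2 := lt_of_not_pow_dvd k2 ((mul_comm _ _).trans e.symm)
    interval_cases b <;> interval_cases c <;> omega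
  · have k1 := add 18 (3 ^ 3) 19 e (by norm_num) (by norm_num)
      (by decide +kernel) (by norm_num) (by norm_num)
    have k2 := add 20 (5 ^ 2) 41 e (by norm_num) (by norm_num)
      (by decide +kernel) (by norm_num) (by norm_num)
    have l1 := lt_of_not_pow_dvd k1 e'.symm
    have l2 := lt_of_not_pow_dvd k2 ((mul_comm _ _).trans e'.symm)
    interval_cases b' <;> interval_cases c' <;> omega
  · have k1 := sub 8 (2 ^ 5) 41 e' (by norm_num) (by norm_num)
      (by decide +kernel) (by norm_num) (by norm_num) (by norm_num)
    have k2 := sub 20 (5 ^ 2) 11 e' (by norm_num) (by norm_num)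
      (by decide +kernel) (by norm_num) (by norm_num) (by norm_num)
    have l1 := lt_of_not_pow_dvd k1 e.symm
    have l2 := lt_of_not_pow_dvd k2 ((mul_comm _ _).trans e.symm)
    interval_cases a <;> interval_cases c <;> omega
  · have k1 := sub 4 (2 ^ 4) 13 e' (by norm_num) (by norm_num)
      (by decide +kernel) (by norm_num) (by norm_num) (by norm_num)
    have k2 := sub 6 (3 ^ 2) 7 e' (by norm_num) (by norm_num)
      (by decide +kernel) (by norm_num) (by norm_num) (by norm_num)
    have l1 := lt_of_not_pow_dvd k1 e.symm
    have l2 := lt_of_not_pow_dvd k2 ((mul_comm _ _).trans e.symm)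
    interval_cases a <;> interval_cases b <;> omega
  · exact absurd (by omega : u = 0) hu.1

theorem five_pow_add_three_ne {a c : ℕ} (ha : 8 ≤ a) : 5 ^ c + 3 ≠ 2 ^ a := by
  intro h
  have h5 := pow_modEq_pow_mod (x := 5) (k := 64) (M := 256 * 641) (by norm_num) c
  have h2 := pow_modEq_pow_mod (x := 2) (k := 64) (M := 641) (by norm_num) a
  have hc : ∀ r < 64, 256 ∣ 5 ^ r + 3 → (5 ^ r + 3) % 641 = (5 ^ 35 + 3) % 641 := by
    decide +kernel
  have h256 : 256 ∣ 5 ^ (c % 64) + 3 :=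
    ((((h5.add_right 3).of_mul_right 641).dvd_iff dvd_rfl).1
      (h ▸ (pow_dvd_pow 2 ha : 2 ^ 8 ∣ 2 ^ a)))
  have e1 := hc _ (Nat.mod_lt _ (by norm_num)) h256
  have e2 : (5 ^ (c % 64) + 3) % 641 = 2 ^ (a % 64) % 641 :=
    ((h5.add_right 3).of_mul_left 256).symm.trans ((h ▸ rfl : (5 ^ c + 3) % 641 = 2 ^ a % 641).trans h2)
  have hd : ∀ r < 64, 2 ^ r % 641 ≠ (5 ^ 35 + 3) % 641 := by decide +kernel
  exact hd _ (Nat.mod_lt _ (by norm_num)) (e2.symm.trans e1)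

theorem lt_of_smooth5_add_three {w : ℕ} (hw : Smooth5 w) (hw' : Smooth5 (w + 3)) : w < 998 := by
  by_contra! hle
  by_cases h3 : 3 ∣ w
  · obtain ⟨u, rfl⟩ := h3
    have := le_eighty_of_smooth5 (hw.of_dvd ⟨3, by ring⟩) (hw'.of_dvd ⟨3, by ring⟩)
    omega
  obtain ⟨a, b, c, e⟩ := hw.exists_eq
  obtain ⟨a', b', c', e'⟩ := hw'.exists_eq
  have hb : b = 0 := by
    by_contra hb
    exact h3 (e ▸ ((dvd_pow_self 3 hb).mul_left _).mul_right _)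
  have hb' : b' = 0 := by
    by_contra hb'
    have : 3 ∣ w + 3 := e' ▸ ((dvd_pow_self 3 hb').mul_left _).mul_right _
    omega
  subst hb hb'
  have h2 : a = 0 ∨ a' = 0 := exponent_eq_zero_or (u := w) (p := 2) (t := 3)
    (M := 5 ^ c) (N := 5 ^ c') (by rw [e]; ring) (by rw [e']; ring) (by norm_num)
  have h5 : c = 0 ∨ c' = 0 := exponent_eq_zero_or (u := w) (p := 5) (t := 3)
    (M := 2 ^ a) (N := 2 ^ a') (by rw [e]; ring) (by rw [e']; ring) (by norm_num)
  rcases h2 with rfl | rfl <;> rcases h5 with rfl | rfl <;>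
    simp only [pow_zero, one_mul, mul_one] at e e'
  · omega
  · refine five_pow_add_three_ne (a := a') (c := c) ?_ (by omega)
    by_contra! h
    have := Nat.pow_le_pow_right (n := 2) (by norm_num) (Nat.le_of_lt_succ h)
    omega
  · have h1 : 5 ^ c' % 4 = 1 := by simp [Nat.pow_mod]
    rcases Nat.lt_or_ge a 2 with h | h
    · interval_cases a <;> omega
    · obtain ⟨s, hs⟩ : 2 ^ 2 ∣ 2 ^ a := pow_dvd_pow 2 h
      omega
  · omega

section slopes

variable {p : ℕ} [hp : Fact p.Prime]

theorem slope_lt_of_mul_eq {x y a b : ℤ} {d i : ℕ} (hx : x ≠ 0) (hy : y ≠ 0) (ha : a ≠ 0)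
    (h : x * a = y * b) (hlt : d * padicValInt p a < i + d * padicValInt p b) :
    d * padicValInt p y < i + d * padicValInt p x := by
  have hb : b ≠ 0 := by
    rintro rfl
    exact mul_ne_zero hx ha (by simpa using h)
  have h1 := congrArg (fun z => d * padicValInt p z) h
  simp only [padicValInt.mul hx ha, padicValInt.mul hy hb, mul_add] at h1
  omega

theorem coeff_hookHe_even_mul (m t : ℕ) :
    (hookHe (2 * m)).coeff (2 * (t + 1)) * (oddProd t : ℕ) =
      (hookHe (2 * m)).coeff 0 * ((-1) ^ t * (m + 1).choose (t + 1)) := by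
  have h0 := coeff_hookHe (2 * m) 0
  have h1 := coeff_hookHe (2 * m) (2 * (t + 1))
  have h2 := coeff_He_even m (t + 1)
  rw [oddProd_succ] at h2
  refine mul_left_cancel₀ (show 2 * (m : ℤ) + 1 ≠ 0 by positivity) ?_
  push_cast at h0 h1 h2 ⊢
  linear_combination (oddProd t : ℤ) * h1 + h2 - (-1) ^ t * ((m + 1).choose (t + 1) : ℤ) * h0

theorem coeff_hookHe_odd_mul (m i : ℕ) :
    (hookHe (2 * m + 1)).coeff (2 * i + 3) * (oddProd (i + 2) : ℕ) =
      (hookHe (2 * m + 1)).coeff 3 * ((-1) ^ i * (m.choose i * 3)) := by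
  have h0 := coeff_hookHe (2 * m + 1) 3
  have h1 := coeff_hookHe (2 * m + 1) (2 * i + 3)
  have h2 := coeff_He_odd m i
  rw [show 2 * m + 1 + 2 = 2 * m + 3 from rfl] at h0 h1
  refine mul_left_cancel₀ (show 2 * (m : ℤ) + 1 + 1 ≠ 0 by positivity) ?_
  push_cast at h0 h1 h2 ⊢
  linear_combination (oddProd (i + 2) : ℤ) * h1 + 2 * h2
    - (-1) ^ i * ((m.choose i : ℤ) * 3) * h0

theorem coeff_hookHe_eq_zero {k i : ℕ} (hk : 0 < k) (h : Odd (k + i)) :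
    (hookHe k).coeff i = 0 := by
  have h1 := coeff_hookHe k i
  rw [coeff_He_eq_zero (k + 2) i (by rw [Nat.odd_iff] at h ⊢; omega), mul_zero] at h1
  exact (mul_eq_zero.1 h1).resolve_left (by positivity)

theorem slope_hookHe_even (h7 : 7 ≤ p) {m d : ℕ} (hm : 0 < m) (hd : d ≤ 7)
    (h0 : (hookHe (2 * m)).coeff 0 ≠ 0) {i : ℕ} (hi : 1 ≤ i) (hne : (hookHe (2 * m)).coeff i ≠ 0) :
    d * padicValInt p ((hookHe (2 * m)).coeff 0) <
      i + d * padicValInt p ((hookHe (2 * m)).coeff i) := by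
  obtain ⟨t, rfl⟩ : ∃ t, i = 2 * (t + 1) := by
    have : ¬ Odd (2 * m + i) := fun h => hne (coeff_hookHe_eq_zero (by omega) h)
    rw [Nat.odd_iff] at this
    exact ⟨i / 2 - 1, by omega⟩
  refine slope_lt_of_mul_eq hne h0 (by exact_mod_cast oddProd_ne_zero t)
    (coeff_hookHe_even_mul m t) ?_
  rw [padicValInt.of_nat]
  have h1 := padicValNat_oddProd_le h7 t
  have h2 := Nat.mul_le_mul_right (padicValNat p (oddProd t)) hd
  omega

theorem dvd_choose_two_three (h7 : 7 ≤ p) {m : ℕ} (h : (p : ℤ) ∣ m * ((m : ℤ) - 1)) :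
    (p : ℤ) ∣ m.choose 2 ∧ (p : ℤ) ∣ m.choose 3 := by
  have hpp : Prime (p : ℤ) := Nat.prime_iff_prime_int.1 hp.out
  have hsmall : ∀ r : ℕ, 0 < r → r < 7 → ¬ (p : ℤ) ∣ (r : ℤ) := fun r h0 hr hdvd => by
    have := Nat.le_of_dvd h0 (Int.natCast_dvd_natCast.1 hdvd)
    omega
  have e2 := cast_choose_succ_mul m 1
  have e3 := cast_choose_succ_mul m 2
  norm_num at e2 e3
  have h2 : (p : ℤ) ∣ m.choose 2 :=
    (hpp.dvd_or_dvd (e2 ▸ h)).resolve_right (hsmall 2 (by norm_num) (by norm_num))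
  exact ⟨h2, (hpp.dvd_or_dvd (e3 ▸ h2.mul_right _)).resolve_right
    (hsmall 3 (by norm_num) (by norm_num))⟩

theorem slope_hookHe_odd (h7 : 7 ≤ p) {m d : ℕ} (hd : d ≤ 7)
    (hdm : d ≤ 3 ∨ (p : ℤ) ∣ m * ((m : ℤ) - 1))
    (h0 : (hookHe (2 * m + 1)).coeff 3 ≠ 0) {i : ℕ} (hi : 1 ≤ i)
    (hne : (hookHe (2 * m + 1)).coeff (i + 3) ≠ 0) :
    d * padicValInt p ((hookHe (2 * m + 1)).coeff 3) <
      i + d * padicValInt p ((hookHe (2 * m + 1)).coeff (i + 3)) := by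
  obtain ⟨t, rfl⟩ : ∃ t, i = 2 * t := by
    have : ¬ Odd (2 * m + 1 + (i + 3)) := fun h => hne (coeff_hookHe_eq_zero (by omega) h)
    rw [Nat.odd_iff] at this
    exact ⟨i / 2, by omega⟩
  have he := coeff_hookHe_odd_mul m t
  have ha : ((oddProd (t + 2) : ℕ) : ℤ) ≠ 0 := by exact_mod_cast oddProd_ne_zero _
  have hb : ((-1) ^ t * (m.choose t * 3) : ℤ) ≠ 0 := fun hb =>
    mul_ne_zero hne ha (by rw [he, hb, mul_zero])
  refine slope_lt_of_mul_eq hne h0 ha he ?_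
  rw [padicValInt.of_nat]
  have h1 := padicValNat_oddProd_le h7 (t + 2)
  rcases Nat.lt_or_ge t 4 with ht | ht
  · rcases Nat.lt_or_ge t 2 with ht' | ht'
    · rw [padicValNat_oddProd_of_le_three h7 (by omega)]
      omega
    have hf : padicValNat p (oddProd (t + 2)) ≤ 1 := by omega
    have hdf := Nat.mul_le_mul_left d hf
    rcases hdm with hd3 | hdvd
    · omega
    · obtain ⟨c2, c3⟩ := dvd_choose_two_three h7 hdvd
      have hc : (p : ℤ) ∣ (-1) ^ t * (m.choose t * 3) := by
        refine Dvd.dvd.mul_left (Dvd.dvd.mul_right ?_ _) _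
        obtain rfl | rfl : t = 2 ∨ t = 3 := by omega
        exacts [c2, c3]
      have hv : 1 ≤ padicValInt p ((-1) ^ t * (m.choose t * 3)) :=
        ((padicValInt_dvd_iff 1 _).1 (by simpa using hc)).resolve_left hb
      have := Nat.mul_le_mul_left d hv
      omega
  · have h2 := padicValNat_oddProd_add_le h7 (show 6 ≤ t + 2 by omega)
    have h3 := Nat.mul_le_mul_right (padicValNat p (oddProd (t + 2))) hd
    omega

end slopes

/-- Lemma `lem:factor7forn1`.  For every `n ≥ 1000`, the polynomial
`R_{n,1}` has no factor in `ℤ[X]` of degree `d` for any `1 ≤ d ≤ 7`. -/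
theorem stmt12 (n : ℕ) (hn : 1000 ≤ n)
    (HeL RL : Polynomial ℤ)
    (hHe : Polynomial.C (vand (degSeq ![n, 1])) * HeL = wronskHe (degSeq ![n, 1]))
    (hR : HeL = Polynomial.X ^ sStat (degSeq ![n, 1]) * RL)
    (hR0 : RL.coeff 0 ≠ 0) :
    ∀ d : ℕ, 1 ≤ d → d ≤ 7 →
      ¬ ∃ g : Polynomial ℤ, g.natDegree = d ∧ g ∣ RL := by
  rintro d hd1 hd7 ⟨g, hg, h, rfl⟩
  obtain ⟨k, rfl⟩ : ∃ k, n = k + 1 := ⟨n - 1, by omega⟩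
  rw [eq_hookHe k HeL hHe] at hR
  have hlc : ∀ p : ℕ, p.Prime → ¬ (p : ℤ) ∣ g.leadingCoeff := by
    intro p hp hdvd
    have hm : (X ^ sStat (degSeq ![k + 1, 1]) * (g * h)).leadingCoeff = 1 := hR ▸ hookHe_monic k
    rw [leadingCoeff_mul, leadingCoeff_mul, leadingCoeff_X_pow, one_mul] at hm
    have h1 : (p : ℤ) ∣ 1 := hm ▸ hdvd.mul_right _
    exact hp.one_lt.ne' (by exact_mod_cast Int.eq_one_of_dvd_one (by positivity) h1)
  have hdvd0 : ∀ p : ℕ, p.Prime → p ≠ 2 → ∀ (N : ℕ) (q : (ZMod p)[X]), q.Monic → q.natDegree < d →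
      (hookHe k).map (Int.castRingHom (ZMod p)) = X ^ N * q → (p : ℤ) ∣ g.coeff 0 := by
    intro p hp h2 N q hq hqd e
    have : Fact p.Prime := ⟨hp⟩
    exact dvd_coeff_zero_of_map_eq hq.ne_zero (hg ▸ hqd) (hlc p hp) (dvd_mul_right g h) (hR ▸ e)
  have hadd : ∀ p : ℕ, p.Prime → 7 ≤ p → p ∣ k + 2 → (p : ℤ) ∣ g.coeff 0 := by
    intro p hp h7 hpk
    have : Fact p.Prime := ⟨hp⟩
    exact hdvd0 p hp (by omega) (k + 2) 1 monic_one (by rw [natDegree_one]; omega)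
      (by rw [hookHe_map_of_dvd_add_two (by omega) hpk, mul_one])
  have hsub : ∀ p : ℕ, p.Prime → 7 ≤ p → p ∣ k - 1 → (p : ℤ) ∣ g.coeff 0 := by
    intro p hp h7 hpk
    have : Fact p.Prime := ⟨hp⟩
    obtain ⟨j, rfl⟩ : ∃ j, k = j + 1 := ⟨k - 1, by omega⟩
    rw [Nat.add_sub_cancel] at hpk
    exact hdvd0 p hp (by omega) (j + 3) 1 monic_one (by rw [natDegree_one]; omega)
      (by rw [hookHe_map_of_dvd_sub_one (by omega) hpk, mul_one])
  rcases Nat.even_or_odd' k with ⟨m, rfl | rfl⟩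
  · rw [sStat_of_odd m, pow_zero, one_mul] at hR
    have hno : ∀ p : ℕ, p.Prime → 7 ≤ p → ¬ (p : ℤ) ∣ g.coeff 0 := by
      intro p hp h7
      have : Fact p.Prime := ⟨hp⟩
      rw [← hR] at hR0
      exact not_dvd_coeff_zero_of_newton hd1 hg (hlc p hp) (hR ▸ hR0) fun i hi hne => by
        rw [← hR] at hne ⊢
        exact slope_hookHe_even h7 (by omega) hd7 hR0 hi hne
    have := lt_of_smooth5_add_three (w := 2 * m - 1)
      ⟨by omega, fun p hp hdvd => by
        by_contra! h7
        exact hno p hp h7 (hsub p hp h7 hdvd)⟩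
      ⟨by omega, fun p hp hdvd => by
        by_contra! h7
        exact hno p hp h7 (hadd p hp h7 (by rwa [show 2 * m + 2 = 2 * m - 1 + 3 by omega]))⟩
    omega
  · rw [sStat_of_even m] at hR
    have hc : ∀ i, (g * h).coeff i = (hookHe (2 * m + 1)).coeff (i + 3) := fun i => by
      rw [hR, coeff_X_pow_mul]
    have hno : ∀ p : ℕ, p.Prime → 7 ≤ p → (d ≤ 3 ∨ (p : ℤ) ∣ m * ((m : ℤ) - 1)) →
        ¬ (p : ℤ) ∣ g.coeff 0 := by
      intro p hp h7 hdm
      have : Fact p.Prime := ⟨hp⟩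
      refine not_dvd_coeff_zero_of_newton hd1 hg (hlc p hp) hR0 fun i hi hne => ?_
      rw [hc] at hR0 hne ⊢
      rw [hc]
      exact slope_hookHe_odd h7 hd7 hdm hR0 hi hne
    have hm : ∀ p : ℕ, p ∣ m → (p : ℤ) ∣ m * ((m : ℤ) - 1) := fun p h =>
      (Int.natCast_dvd_natCast.2 h).mul_right _
    rcases Nat.lt_or_ge 3 d with hd3 | hd3
    · have := le_eighty_of_smooth5 (u := m - 1)
        ⟨by omega, fun p hp hdvd => by
          by_contra! h7
          have : Fact p.Prime := ⟨hp⟩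
          obtain ⟨j, rfl⟩ : ∃ j, m = j + 1 := ⟨m - 1, by omega⟩
          have hj : p ∣ 2 * j := Dvd.dvd.mul_left hdvd 2
          refine hno p hp h7 (Or.inr ?_) (hdvd0 p hp (by omega) (2 * j + 3) (X ^ 2 - C 5)
            (monic_X_pow_sub_C 5 (by norm_num)) ?_ (hookHe_map_of_dvd_sub_three (by omega) hj))
          · push_cast
            rw [add_sub_cancel_right]
            exact (Int.natCast_dvd_natCast.2 hdvd).mul_left _
          · rw [natDegree_X_pow_sub_C]
            omega⟩
        ⟨by omega, fun p hp hdvd => by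
          by_contra! h7
          have hpm : p ∣ m := by rwa [show m - 1 + 1 = m by omega] at hdvd
          exact hno p hp h7 (Or.inr (hm p hpm)) (hsub p hp h7 (Dvd.dvd.mul_left hpm 2))⟩
      omega
    · have := lt_of_smooth5_add_three (w := 2 * m)
        ⟨by omega, fun p hp hdvd => by
          by_contra! h7
          exact hno p hp h7 (Or.inl hd3) (hsub p hp h7 hdvd)⟩
        ⟨by omega, fun p hp hdvd => by
          by_contra! h7
          exact hno p hp h7 (Or.inl hd3) (hadd p hp h7 hdvd)⟩
      omega
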